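/- arXiv:1706.04283 — 8 statements merged into one kernel-verified Lean document; each statement's English description precedes it below -/
import Mathlib

section
/- Let q be a prime power, m a positive integer, and F = 𝔽_{q^m}. Let 0 ≤ k ≤ n and let f_k, f_{k+1}, …, f_n ∈ F. Then there exist g_0, …, g_{n−k} ∈ F with g_i^{q^k} = f_{i+k} for all 0 ≤ i ≤ n−k, and in the polynomial ring F[y] one has the identity ∑_{i=k}^{n} f_i y^{⟦i⟧} = y^{⟦k⟧} · (∑_{i=0}^{n−k} g_i y^{⟦i⟧})^{q^k}. -/
open Polynomial

/-- `⟦i⟧ = ∑_{j=0}^{i-1} q^j = (q^i - 1)/(q - 1)`. -/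
def qbrack (q i : ℕ) : ℕ := ∑ j ∈ Finset.range i, q ^ j

/-- Splitting off the first `k` terms of the geometric sum. -/
theorem qbrack_add (q k i : ℕ) : qbrack q (k + i) = qbrack q k + q ^ k * qbrack q i := by
  simp only [qbrack, Finset.sum_range_add, Finset.mul_sum, pow_add]

/-- Factoring the lowest term out of a right evaluation polynomial:
`∑_{i=k}^n f_i y^⟦i⟧ = y^⟦k⟧ (∑_{i=0}^{n-k} g_i y^⟦i⟧)^{q^k}` where `g_i^{q^k} = f_{i+k}`. -/
theorem eval_poly_factor (q m : ℕ) (hq : IsPrimePow q) (hm : 0 < m)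
    (F : Type*) [Field F] [Fintype F] (hF : Fintype.card F = q ^ m)
    (k n : ℕ) (hkn : k ≤ n) (f : ℕ → F) :
    ∃ g : ℕ → F, (∀ i ≤ n - k, (g i) ^ (q ^ k) = f (i + k)) ∧
      (∑ i ∈ Finset.Icc k n, C (f i) * X ^ qbrack q i) =
        X ^ qbrack q k *
          (∑ i ∈ Finset.range (n - k + 1), C (g i) * X ^ qbrack q i) ^ (q ^ k) := by
  obtain ⟨p, e, hp, -, rfl⟩ := hq
  have : Fact p.Prime := ⟨hp.nat_prime⟩
  have : CharP F p := charP_of_card_eq_prime_pow (f := e * m) (by rw [hF, pow_mul])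
  have hroot (a : F) : ∃ b : F, b ^ ((p ^ e) ^ k) = a := by
    obtain ⟨b, hb⟩ := (bijective_iterateFrobenius F p (e * k)).2 a
    exact ⟨b, by rwa [iterateFrobenius_def, pow_mul] at hb⟩
  choose g hg using fun i => hroot (f (i + k))
  refine ⟨g, fun i _ => hg i, ?_⟩
  rw [← pow_mul p e k, sum_pow_char_pow, pow_mul p e k, Finset.mul_sum,
    ← Finset.Ico_add_one_right_eq_Icc, Finset.sum_Ico_eq_sum_range, Nat.sub_add_comm hkn]
  refine Finset.sum_congr rfl fun i _ => ?_
  rw [mul_pow, ← C_pow, hg, qbrack_add, add_comm i k]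
  ring
end

section
/- Let q be a prime power, m a positive integer, F = 𝔽_{q^m}, and u ∈ F^*. Then for any a_1, …, a_n ∈ F, the family (a_1, …, a_n) is right independent if and only if the family (u a_1, …, u a_n) is right independent. -/
/-- `(a_1, …, a_n)` is right independent: the only coefficient tuple whose right evaluation
vanishes at every `a_j` is zero. -/
def RightIndep (q : ℕ) {F : Type*} [Field F] {n : ℕ} (a : Fin n → F) : Prop :=
  ∀ f : Fin n → F,
    (∀ j : Fin n, ∑ i : Fin n, f i * (a j) ^ qbrack q (i : ℕ) = 0) → f = 0

/-- Rescaling the coefficients by powers of `u` absorbs a nonzero scalar. -/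
theorem RightIndep.const_mul {q : ℕ} {F : Type*} [Field F] {n : ℕ} {a : Fin n → F} {u : F}
    (hu : u ≠ 0) (h : RightIndep q a) : RightIndep q (fun j => u * a j) := by
  intro f hf
  have key := h (fun i => f i * u ^ qbrack q (i : ℕ)) fun j => by
    simpa only [mul_pow, mul_assoc] using hf j
  funext i
  exact (mul_eq_zero.mp (congrFun key i)).resolve_right (pow_ne_zero _ hu)

/-- Right independence is preserved by multiplication by a nonzero scalar `u`. -/
theorem rightIndep_smul_iff (q m : ℕ) (hq : IsPrimePow q) (hm : 0 < m)
    (F : Type*) [Field F] [Fintype F] (hF : Fintype.card F = q ^ m)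
    (u : F) (hu : u ≠ 0) (n : ℕ) (a : Fin n → F) :
    RightIndep q a ↔ RightIndep q (fun j => u * a j) := by
  refine ⟨RightIndep.const_mul hu, fun h => ?_⟩
  simpa only [inv_mul_cancel_left₀ hu] using h.const_mul (inv_ne_zero hu)
end

section
/- Let q be a prime power, m a positive integer, and F = 𝔽_{q^m}. Let b_1, …, b_n ∈ F^* and set a_j = b_j^{q−1} for each j. Let d ∈ ℕ and f_0, …, f_{d−1} ∈ F with f_d := 1 be such that ∑_{i=0}^{d} f_i a_j^{⟦i⟧} = 0 for all j ∈ {1,…,n}, and suppose d is minimal, i.e., there is no d' < d and tuple g_0, …, g_{d'−1} ∈ F with g_{d'} := 1 satisfying ∑_{i=0}^{d'} g_i a_j^{⟦i⟧} = 0 for all j. Then {a ∈ F : ∑_{i=0}^{d} f_i a^{⟦i⟧} = 0} = {(∑_{j=1}^{n} c_j b_j)^{q−1} : c_1, …, c_n ∈ 𝔽_q, ∑_{j=1}^{n} c_j b_j ≠ 0}. -/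
open Polynomial in
/-- The linearized polynomial `∑_{i < N} g_i X^{q^i}`. -/
noncomputable def linearizedPoly {R : Type*} [CommRing R] (q N : ℕ) (g : ℕ → R) : R[X] :=
  ∑ i ∈ Finset.range N, C (g i) * X ^ q ^ i

namespace linearizedPoly

open Polynomial

section Coeff

variable {R : Type*} [CommRing R] {q : ℕ}

theorem aeval_eq {A : Type*} [CommRing A] [Algebra R A] (N : ℕ) (g : ℕ → R) (x : A) :
    aeval x (linearizedPoly q N g) = ∑ i ∈ Finset.range N, algebraMap R A (g i) * x ^ q ^ i := by
  simp [linearizedPoly]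

theorem eval_eq (N : ℕ) (g : ℕ → R) (x : R) :
    (linearizedPoly q N g).eval x = ∑ i ∈ Finset.range N, g i * x ^ q ^ i := by
  simp [linearizedPoly, eval_finsetSum]

theorem coeff_pow (hq : 1 < q) {N i : ℕ} (hi : i < N) (g : ℕ → R) :
    (linearizedPoly q N g).coeff (q ^ i) = g i := by
  simp only [linearizedPoly, finsetSum_coeff, coeff_C_mul_X_pow]
  rw [Finset.sum_eq_single_of_mem i (Finset.mem_range.2 hi)]
  · simp
  · intro j _ hj
    exact if_neg fun h => hj (Nat.pow_right_injective hq h).symm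

theorem coeff_zero (hq : 1 < q) (N : ℕ) (g : ℕ → R) : (linearizedPoly q N g).coeff 0 = 0 := by
  simp only [linearizedPoly, finsetSum_coeff, coeff_C_mul_X_pow]
  exact Finset.sum_eq_zero fun i _ => if_neg (pow_pos (by omega : 0 < q) i).ne

theorem natDegree_succ_le (hq : 1 < q) (N : ℕ) (g : ℕ → R) :
    (linearizedPoly q (N + 1) g).natDegree ≤ q ^ N := by
  refine natDegree_sum_le_of_forall_le _ _ fun i hi => ?_
  refine (natDegree_C_mul_X_pow_le _ _).trans ?_
  exact Nat.pow_le_pow_right (by omega) (Nat.lt_succ_iff.1 (Finset.mem_range.1 hi))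

theorem natDegree_lt (hq : 1 < q) (N : ℕ) (g : ℕ → R) :
    (linearizedPoly q N g).natDegree < q ^ N := by
  cases N with
  | zero => simp [linearizedPoly]
  | succ N =>
    exact (natDegree_succ_le hq N g).trans_lt (Nat.pow_lt_pow_right hq N.lt_succ_self)

theorem monic (hq : 1 < q) {N : ℕ} {g : ℕ → R} (hg : g N = 1) :
    (linearizedPoly q (N + 1) g).Monic :=
  monic_of_natDegree_le_of_coeff_eq_one _ (natDegree_succ_le hq N g)
    ((coeff_pow hq N.lt_succ_self g).trans hg)

/-- Evaluating a linearized polynomial at `c` is evaluating the associated skew polynomial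
at `c ^ (q - 1)`, up to the factor `c`. -/
theorem mul_sum_pow_qbrack (hq : 0 < q) (N : ℕ) (g : ℕ → R) (c : R) :
    c * ∑ i ∈ Finset.range N, g i * (c ^ (q - 1)) ^ qbrack q i =
      ∑ i ∈ Finset.range N, g i * c ^ q ^ i := by
  rw [Finset.mul_sum]
  refine Finset.sum_congr rfl fun i _ => ?_
  have h : (q - 1) * qbrack q i + 1 = q ^ i := by
    obtain ⟨r, rfl⟩ := Nat.exists_eq_add_of_le' hq
    rw [mul_comm, Nat.add_sub_cancel]
    exact geom_sum_mul_add r i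
  rw [← h, ← pow_mul, pow_succ]
  ring

end Coeff

section Span

variable {K F : Type*} [Field K] [Fintype K] [Field F] [Algebra K F]

/-- The evaluation map of a linearized polynomial with `q = #K`, as a `K`-linear map. -/
noncomputable def evalLinear (K : Type*) {F : Type*} [Field K] [Fintype K] [Field F] [Algebra K F]
    (N : ℕ) (g : ℕ → F) : F →ₗ[K] F :=
  ∑ i ∈ Finset.range N, g i • (FiniteField.frobeniusAlgHom K F ^ i).toLinearMap

theorem evalLinear_apply (N : ℕ) (g : ℕ → F) (x : F) :
    evalLinear K N g x = ∑ i ∈ Finset.range N, g i * x ^ Fintype.card K ^ i := by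
  simp [evalLinear, LinearMap.sum_apply, AlgHom.coe_pow, FiniteField.coe_frobeniusAlgHom,
    pow_iterate]

variable [Finite F]

/-- There is a monic linearized polynomial of `q`-degree `dim V` vanishing on `V`. -/
theorem exists_vanishing (V : Submodule K F) :
    ∃ g : ℕ → F, g (Module.finrank K V) = 1 ∧
      V ≤ LinearMap.ker (evalLinear K (Module.finrank K V + 1) g) := by
  classical
  set k := Module.finrank K V with hk
  set q := Fintype.card K with hq
  have hq1 : 1 < q := Fintype.one_lt_card
  let β := Module.finBasis K V
  have hV : ∀ N (g : ℕ → F), (∀ j, evalLinear K N g (β j) = 0) →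
      V ≤ LinearMap.ker (evalLinear K N g) := by
    intro N g h v hv
    have : (evalLinear K N g).comp V.subtype = 0 := β.ext fun j => h j
    exact LinearMap.congr_fun this ⟨v, hv⟩
  let M : Matrix (Fin k) (Fin k) F := Matrix.of fun j i => (β j : F) ^ q ^ (i : ℕ)
  have hM : ∀ (g : ℕ → F) (j), M.mulVec (fun i : Fin k => g i) j = evalLinear K k g (β j) := by
    intro g j
    rw [evalLinear_apply, Finset.sum_range, Matrix.mulVec, dotProduct]
    exact Finset.sum_congr rfl fun i _ => mul_comm (M j i) (g i)
  have hext : ∀ (g : Fin k → F) (t : F), ∃ g' : ℕ → F, (∀ i : Fin k, g' i = g i) ∧ g' k = t :=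
    fun g t => ⟨fun i => if h : i < k then g ⟨i, h⟩ else t, by simp, by simp⟩
  have hinj : Function.Injective M.mulVecLin := by
    rw [← LinearMap.ker_eq_bot, LinearMap.ker_eq_bot']
    intro g hg
    obtain ⟨g', hg', -⟩ := hext g 0
    obtain rfl : (fun i : Fin k => g' i) = g := funext hg'
    have hle := hV k g' fun j => by rw [← hM, ← Matrix.mulVecLin_apply, hg]; rfl
    have hzero : linearizedPoly q k g' = 0 := by
      have : Fintype V := Fintype.ofFinite V
      refine eq_zero_of_natDegree_lt_card_of_eval_eq_zero _ (f := fun v : V => (v : F))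
        Subtype.val_injective (fun v => ?_) ?_
      · rw [eval_eq, hq, ← evalLinear_apply]
        exact hle v.2
      · rw [Module.card_eq_pow_finrank (K := K) (V := V)]
        exact natDegree_lt hq1 k g'
    funext i
    have := coeff_pow hq1 i.2 g'
    rw [hzero] at this
    simpa using this.symm
  obtain ⟨g, hg⟩ := LinearMap.injective_iff_surjective.1 hinj fun j => -(β j : F) ^ q ^ k
  obtain ⟨g', hg', hk'⟩ := hext g 1
  obtain rfl : (fun i : Fin k => g' i) = g := funext hg'
  refine ⟨g', hk', hV _ _ fun j => ?_⟩
  have := congrFun hg j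
  rw [Matrix.mulVecLin_apply, hM, evalLinear_apply] at this
  rw [evalLinear_apply, Finset.sum_range_succ, this, hk', one_mul, neg_add_cancel]

/-- A monic linearized polynomial of `q`-degree at most `dim V` vanishing on `V` has the elements
of `V` as its simple roots, and no others. -/
theorem roots_eq (V : Submodule K F) {d : ℕ} (hd : d ≤ Module.finrank K V) {f : ℕ → F}
    (hf : f d = 1) (hV : V ≤ LinearMap.ker (evalLinear K (d + 1) f)) :
    ∃ s : Finset F, (s : Set F) = V ∧
      (linearizedPoly (Fintype.card K) (d + 1) f).roots = s.val ∧
      ∏ v ∈ s, (X - C v) = linearizedPoly (Fintype.card K) (d + 1) f := by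
  have hq1 : 1 < Fintype.card K := Fintype.one_lt_card
  have hmon := monic hq1 hf
  set P := linearizedPoly (Fintype.card K) (d + 1) f with hP
  obtain ⟨s, hs⟩ := (Set.toFinite (V : Set F)).exists_finset_coe
  have hcard : s.card = Fintype.card K ^ Module.finrank K V := by
    rw [← Set.ncard_coe_finset, hs, ← Nat.card_eq_fintype_card]
    exact Module.natCard_eq_pow_finrank (K := K) (V := V)
  have hsub : s.val ≤ P.roots := by
    refine (Multiset.le_iff_subset s.nodup).2 fun v hv => ?_
    rw [mem_roots hmon.ne_zero, IsRoot, hP, eval_eq, ← evalLinear_apply (K := K)]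
    exact hV (by rw [← SetLike.mem_coe, ← hs]; exact hv)
  have hle : P.roots.card ≤ s.val.card :=
    (card_roots' P).trans <| (natDegree_succ_le hq1 d f).trans <| by
      rw [Finset.card_val, hcard]
      exact Nat.pow_le_pow_right (by omega) hd
  have hroots := (Multiset.eq_of_le_of_card_le hsub hle).symm
  refine ⟨s, hs, hroots, ?_⟩
  have hdeg : P.roots.card = P.natDegree := by
    refine (card_roots' P).antisymm ((natDegree_succ_le hq1 d f).trans ?_)
    rw [hroots, Finset.card_val, hcard]
    exact Nat.pow_le_pow_right (by omega) hd
  have := prod_multiset_X_sub_C_of_monic_of_roots_card_eq hmon hdeg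
  rwa [hroots] at this

/-- The skew roots attached to a monic linearized polynomial of `q`-degree at most `dim V`
vanishing on `V` are the `v ^ (q - 1)` with `v ∈ V` nonzero. -/
theorem sum_pow_qbrack_eq_zero_iff (V : Submodule K F) {d : ℕ} (hd : d ≤ Module.finrank K V)
    {f : ℕ → F} (hf : f d = 1) (hV : V ≤ LinearMap.ker (evalLinear K (d + 1) f)) (x : F) :
    ∑ i ∈ Finset.range (d + 1), f i * x ^ qbrack (Fintype.card K) i = 0 ↔
      ∃ v ∈ V, v ≠ 0 ∧ x = v ^ (Fintype.card K - 1) := by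
  have hq1 : 1 < Fintype.card K := Fintype.one_lt_card
  have hmon := monic hq1 hf
  obtain ⟨s, hs, hroots, hprod⟩ := roots_eq V hd hf hV
  set q := Fintype.card K with hq
  constructor
  · intro hx
    have hx0 : x ≠ 0 := by
      rintro rfl
      have hf0 : f 0 = 0 := by
        rw [Finset.sum_range_succ', Finset.sum_eq_zero] at hx
        · simpa [qbrack] using hx
        · intro i _
          rw [zero_pow, mul_zero]
          simp [qbrack, Finset.sum_range_succ']
      have hdvd : X ^ 2 ∣ linearizedPoly q (d + 1) f := by
        rw [X_pow_dvd_iff]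
        intro i hi
        interval_cases i
        · exact coeff_zero hq1 _ _
        · simpa [hf0] using coeff_pow hq1 d.succ_pos f
      have h2 : 2 ≤ (linearizedPoly q (d + 1) f).rootMultiplicity 0 := by
        rw [le_rootMultiplicity_iff hmon.ne_zero]
        simpa using hdvd
      classical
      rw [← count_roots, hroots] at h2
      have := Multiset.nodup_iff_count_le_one.1 s.nodup 0
      omega
    obtain ⟨c, hc⟩ := IsAlgClosed.exists_pow_nat_eq (algebraMap F (AlgebraicClosure F) x)
      (Nat.sub_pos_of_lt hq1)
    have hroot : aeval c (linearizedPoly q (d + 1) f) = 0 := by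
      rw [aeval_eq, ← mul_sum_pow_qbrack (by omega), hc]
      have := congrArg (algebraMap F (AlgebraicClosure F)) hx
      simp only [map_sum, map_mul, map_pow, map_zero] at this
      rw [this, mul_zero]
    rw [← hprod, map_prod, Finset.prod_eq_zero_iff] at hroot
    obtain ⟨v, hv, hcv⟩ := hroot
    rw [map_sub, aeval_X, aeval_C, sub_eq_zero] at hcv
    have hxv : x = v ^ (q - 1) :=
      (algebraMap F (AlgebraicClosure F)).injective (by rw [map_pow, ← hcv, hc])
    refine ⟨v, by rw [← SetLike.mem_coe, ← hs]; exact hv, ?_, hxv⟩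
    rintro rfl
    exact hx0 (by rw [hxv, zero_pow (by omega)])
  · rintro ⟨v, hv, hv0, rfl⟩
    have := hV hv
    rw [LinearMap.mem_ker, evalLinear_apply, ← hq, ← mul_sum_pow_qbrack (by omega)] at this
    exact (mul_eq_zero.1 this).resolve_left hv0

end Span

end linearizedPoly

/-- In a field with `q ^ m` elements, `q` a prime power, the fixed points of `x ↦ x ^ q` form a
subfield with `q` elements. -/
theorem exists_subfield_card_eq {q m : ℕ} (hq : IsPrimePow q) (hm : 0 < m)
    (F : Type*) [Field F] [Fintype F] (hF : Fintype.card F = q ^ m) :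
    ∃ K : Subfield F, (∀ x, x ∈ K ↔ x ^ q = x) ∧ Nat.card K = q := by
  have hq1 := hq.one_lt
  obtain ⟨p, e, hp, he, rfl⟩ := hq
  have hp := hp.nat_prime
  have : Fact p.Prime := ⟨hp⟩
  have : CharP F p := by
    obtain ⟨r, hr⟩ := CharP.exists F
    obtain ⟨N, hr', hN⟩ := FiniteField.card F r
    have : p ∣ r ^ (N : ℕ) := by
      rw [← hN, hF, ← pow_mul]
      exact dvd_pow_self p (by positivity)
    rwa [(Nat.prime_dvd_prime_iff_eq hp hr').1 (hp.dvd_of_dvd_pow this)]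
  set q := p ^ e
  let K := (iterateFrobenius F p e).eqLocusField (RingHom.id F)
  have hK : ∀ x, x ∈ K ↔ x ^ q = x := fun x => by
    rw [RingHom.mem_eqLocusField, iterateFrobenius_def]; rfl
  refine ⟨K, hK, ?_⟩
  have hker : Nat.card (powMonoidHom (q - 1) : Fˣ →* Fˣ).ker = q - 1 := by
    rw [IsCyclic.card_powMonoidHom_ker, Nat.card_units, Nat.card_eq_fintype_card, hF]
    exact Nat.gcd_eq_right (by simpa using Nat.sub_dvd_pow_sub_pow q 1 m)
  have hset : (K : Set F) =
      insert 0 (Units.val '' ((powMonoidHom (q - 1) : Fˣ →* Fˣ).ker : Set Fˣ)) := by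
    ext x
    rw [SetLike.mem_coe, hK, Set.mem_insert_iff, Set.mem_image]
    have hx : x ^ q = x * x ^ (q - 1) := by rw [← pow_succ', Nat.sub_add_cancel hq1.le]
    constructor
    · intro h
      refine or_iff_not_imp_left.2 fun h0 => ⟨Units.mk0 x h0, ?_, rfl⟩
      rw [SetLike.mem_coe, MonoidHom.mem_ker, powMonoidHom_apply, Units.ext_iff]
      rw [hx] at h
      simpa using mul_left_cancel₀ h0 (h.trans (mul_one x).symm)
    · rintro (rfl | ⟨u, hu, rfl⟩)
      · exact zero_pow (by omega)
      · rw [SetLike.mem_coe, MonoidHom.mem_ker, powMonoidHom_apply, Units.ext_iff] at hu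
        rw [hx, ← Units.val_pow_eq_pow_val, hu, Units.val_one, mul_one]
  change Nat.card (K : Set F) = q
  rw [Nat.card_coe_set_eq, hset, Set.ncard_insert_of_notMem (by simp),
    Set.ncard_image_of_injective _ Units.val_injective, ← Nat.card_coe_set_eq]
  change Nat.card (powMonoidHom (q - 1) : Fˣ →* Fˣ).ker + 1 = q
  omega

/-- Right closure of `Z = {b_1^{q-1}, …, b_n^{q-1}} ⊆ [1]`: the set of right roots of the
right minimal polynomial of `Z` (monic coefficient tuple `f` of minimal degree `d`) is
`{(∑ c_j b_j)^{q-1} : c_j ∈ 𝔽_q, ∑ c_j b_j ≠ 0}`, where `𝔽_q ⊆ F` is the subfield of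
elements fixed by `x ↦ x^q`. -/
theorem right_closure_description (q m : ℕ) (hq : IsPrimePow q) (hm : 0 < m)
    (F : Type*) [Field F] [Fintype F] (hF : Fintype.card F = q ^ m)
    (n : ℕ) (b : Fin n → F) (hb : ∀ j, b j ≠ 0)
    (a : Fin n → F) (ha : ∀ j, a j = (b j) ^ (q - 1))
    (d : ℕ) (f : ℕ → F) (hfd : f d = 1)
    (hroot : ∀ j, ∑ i ∈ Finset.range (d + 1), f i * (a j) ^ qbrack q i = 0)
    (hmin : ¬ ∃ d' < d, ∃ g : ℕ → F, g d' = 1 ∧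
      ∀ j, ∑ i ∈ Finset.range (d' + 1), g i * (a j) ^ qbrack q i = 0) :
    {x : F | ∑ i ∈ Finset.range (d + 1), f i * x ^ qbrack q i = 0} =
      {x : F | ∃ c : Fin n → F, (∀ j, (c j) ^ q = c j) ∧
        (∑ j, c j * b j ≠ 0) ∧ x = (∑ j, c j * b j) ^ (q - 1)} := by
  classical
  obtain ⟨K, hK, hcard⟩ := exists_subfield_card_eq hq hm F hF
  have hq0 : 0 < q := hq.pos
  obtain rfl : Fintype.card K = q := by rw [← Nat.card_eq_fintype_card, hcard]
  let V := Submodule.span K (Set.range b)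
  have hmem : ∀ N (g : ℕ → F), V ≤ LinearMap.ker (linearizedPoly.evalLinear K N g) ↔
      ∀ j, ∑ i ∈ Finset.range N, g i * (a j) ^ qbrack (Fintype.card K) i = 0 := by
    intro N g
    rw [Submodule.span_le, Set.range_subset_iff]
    refine forall_congr' fun j => ?_
    rw [SetLike.mem_coe, LinearMap.mem_ker, linearizedPoly.evalLinear_apply,
      ← linearizedPoly.mul_sum_pow_qbrack hq0, ha, mul_eq_zero_iff_left (hb j)]
  have hd : d ≤ Module.finrank K V := by
    by_contra! h
    obtain ⟨g, hg, hgV⟩ := linearizedPoly.exists_vanishing V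
    exact hmin ⟨_, h, g, hg, (hmem _ g).1 hgV⟩
  ext x
  rw [Set.mem_ofPred_eq, Set.mem_ofPred_eq,
    linearizedPoly.sum_pow_qbrack_eq_zero_iff V hd hfd ((hmem _ f).2 hroot)]
  constructor
  · rintro ⟨v, hv, hv0, rfl⟩
    obtain ⟨c, rfl⟩ := (Submodule.mem_span_range_iff_exists_fun K).1 hv
    exact ⟨fun j => c j, fun j => (hK _).1 (c j).2, hv0, rfl⟩
  · rintro ⟨c, hc, hc0, rfl⟩
    exact ⟨_, (Submodule.mem_span_range_iff_exists_fun K).2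
      ⟨fun j => ⟨c j, (hK _).2 (hc j)⟩, rfl⟩, hc0, rfl⟩
end

section
/- Let q be a prime power, m ≥ 2 an integer, and F = 𝔽_{q^m}. Let b_1, …, b_n ∈ F^* and set a_j = b_j^{q^{m−1}−1} for each j. Let d ∈ ℕ and f_0, …, f_{d−1} ∈ F with f_d := 1 be such that ∑_{i=0}^{d} f_i a_j^{⟧i⟦} = 0 for all j ∈ {1,…,n}, and suppose d is minimal, i.e., there is no d' < d and tuple g_0, …, g_{d'−1} ∈ F with g_{d'} := 1 satisfying ∑_{i=0}^{d'} g_i a_j^{⟧i⟦} = 0 for all j. Then {a ∈ F : ∑_{i=0}^{d} f_i a^{⟧i⟦} = 0} = {(∑_{j=1}^{n} c_j b_j)^{q^{m−1}−1} : c_1, …, c_n ∈ 𝔽_q, ∑_{j=1}^{n} c_j b_j ≠ 0}. -/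
/-- `⟧i⟦ = ∑_{j=0}^{i-1} q^{j(m-1)} = (q^{i(m-1)} - 1)/(q^{m-1} - 1)`. -/
def qbrackRev (q m i : ℕ) : ℕ := ∑ j ∈ Finset.range i, q ^ (j * (m - 1))

namespace FrobeniusOperator

open Finset

variable {K F : Type*} [Field K] [Field F] [Algebra K F] (T : F →ₐ[K] F)

/-- The operator `∑_{i<n} f_i T^i` attached to the endomorphism `T`. -/
def skewOp (f : ℕ → F) (n : ℕ) : F →ₗ[K] F :=
  ∑ i ∈ range n, f i • (T ^ i).toLinearMap

/-- The linear operator `T - x`. -/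
def linOp (x : F) : F →ₗ[K] F := T.toLinearMap - x • LinearMap.id

/-- The norm-like product `∏_{j<i} T^j x`. -/
def partialNorm (x : F) (i : ℕ) : F := ∏ j ∈ range i, (T ^ j) x

lemma skewOp_apply (f : ℕ → F) (n : ℕ) (y : F) :
    skewOp T f n y = ∑ i ∈ range n, f i * (T ^ i) y := by
  simp [skewOp]

lemma linOp_apply (x y : F) : linOp T x y = T y - x * y := by
  simp [linOp]

lemma pow_linOp_apply (x y : F) (i : ℕ) :
    (T ^ i) (linOp T x y) = (T ^ (i + 1)) y - (T ^ i) x * (T ^ i) y := by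
  simp [linOp_apply, pow_succ]

/-- Right division of `∑_{i≤n} f_i T^i` by `T - x`. -/
lemma exists_skewOp_eq_comp_linOp_add (x : F) (n : ℕ) (f : ℕ → F) :
    ∃ g : ℕ → F, (∀ k, n = k + 1 → g k = f n) ∧ ∀ y, skewOp T f (n + 1) y =
      skewOp T g n (linOp T x y) + (∑ i ∈ range (n + 1), f i * partialNorm T x i) * y := by
  induction n generalizing f with
  | zero => exact ⟨f, by simp, by simp [skewOp_apply, partialNorm]⟩
  | succ n ih =>
    obtain ⟨g, -, hg⟩ := ih (Function.update f n (f n + f (n + 1) * (T ^ n) x))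
    refine ⟨Function.update g n (f (n + 1)), by simp, fun y => ?_⟩
    have hf (c : F) (h : ℕ → F) (u : ℕ → F) :
        ∑ i ∈ range n, Function.update h n c i * u i = ∑ i ∈ range n, h i * u i :=
      sum_congr rfl fun i hi => by
        rw [Function.update_of_ne (mem_range.1 hi).ne]
    have h := hg y
    simp only [skewOp_apply, sum_range_succ, hf, Function.update_self, pow_linOp_apply] at h ⊢
    have hN : partialNorm T x (n + 1) = partialNorm T x n * (T ^ n) x := by
      simp [partialNorm, prod_range_succ]
    rw [hN]
    linear_combination h

/-- Composing a monic operator with `T - x` gives a monic operator of degree one more. -/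
lemma exists_skewOp_eq_comp_linOp (x : F) (n : ℕ) (g : ℕ → F) :
    ∃ f : ℕ → F, f (n + 1) = g n ∧
      ∀ y, skewOp T f (n + 2) y = skewOp T g (n + 1) (linOp T x y) := by
  refine ⟨fun i => (if i = 0 then 0 else g (i - 1)) -
    if i = n + 1 then 0 else g i * (T ^ i) x, by simp, fun y => ?_⟩
  have h : ∑ i ∈ range (n + 1), (if i = n + 1 then 0 else g i * (T ^ i) x) * (T ^ i) y =
      ∑ i ∈ range (n + 1), g i * (T ^ i) x * (T ^ i) y :=
    sum_congr rfl fun i hi => by rw [if_neg (mem_range.1 hi).ne]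
  simp only [skewOp_apply, sub_mul, sum_sub_distrib, pow_linOp_apply, mul_sub]
  rw [sum_range_succ' _ (n + 1), sum_range_succ (n := n + 1), h]
  simp [mul_assoc]

lemma partialNorm_mul {x y : F} (h : T y = x * y) (i : ℕ) :
    partialNorm T x i * y = (T ^ i) y := by
  induction i with
  | zero => simp [partialNorm]
  | succ i ih =>
    have : partialNorm T x (i + 1) = partialNorm T x i * (T ^ i) x := by
      simp [partialNorm, prod_range_succ]
    rw [this, pow_succ, AlgHom.mul_apply, h, map_mul, ← ih]
    ring

lemma skewOp_eq_sum_mul {x y : F} (h : T y = x * y) (f : ℕ → F) (n : ℕ) :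
    skewOp T f n y = (∑ i ∈ range n, f i * partialNorm T x i) * y := by
  simp only [skewOp_apply, sum_mul, mul_assoc, partialNorm_mul T h]

variable [FiniteDimensional K F]

lemma finrank_map_linOp (hT : ∀ y, T y = y → ∃ c : K, algebraMap K F c = y)
    {U : Submodule K F} {u : F} (hu : u ∈ U) (hu0 : u ≠ 0) :
    Module.finrank K (U.map (linOp T (T u / u))) + 1 = Module.finrank K U := by
  set φ := linOp T (T u / u)
  have hker : LinearMap.ker (φ.domRestrict U) = Submodule.span K {⟨u, hu⟩} := by
    ext ⟨y, hy⟩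
    rw [LinearMap.mem_ker, LinearMap.domRestrict_apply, linOp_apply,
      Submodule.mem_span_singleton]
    have hTu : T u ≠ 0 := by simpa using hu0
    constructor
    · intro h
      obtain ⟨c, hc⟩ := hT (y / u) (by
        rw [map_div₀, div_eq_div_iff hTu hu0]
        field_simp at h
        linear_combination h)
      refine ⟨c, Subtype.ext ?_⟩
      simp [Algebra.smul_def, hc, hu0]
    · rintro ⟨c, hc⟩
      obtain rfl : c • u = y := congrArg Subtype.val hc
      simp only [Algebra.smul_def, map_mul, AlgHom.commutes]
      field_simp
      ring
  have h := LinearMap.finrank_range_add_finrank_ker (φ.domRestrict U)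
  rwa [hker, LinearMap.range_domRestrict, finrank_span_singleton (by simpa using hu0)] at h

/-- A monic operator of degree `n` has kernel of dimension at most `n`. -/
lemma finrank_le_of_skewOp_eq_zero (hT : ∀ y, T y = y → ∃ c : K, algebraMap K F c = y)
    (n : ℕ) (f : ℕ → F) (hf : f n = 1) (U : Submodule K F)
    (hU : ∀ u ∈ U, skewOp T f (n + 1) u = 0) : Module.finrank K U ≤ n := by
  induction n generalizing f U with
  | zero =>
    have : U = ⊥ := (Submodule.eq_bot_iff _).2 fun u hu => by
      simpa [skewOp_apply, hf] using hU u hu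
    simp [this]
  | succ n ih =>
    rcases eq_or_ne U ⊥ with rfl | hne
    · simp
    obtain ⟨u, hu, hu0⟩ := U.ne_bot_iff.1 hne
    obtain ⟨g, hg, hfg⟩ := exists_skewOp_eq_comp_linOp_add T (T u / u) (n + 1) f
    have hφu : linOp T (T u / u) u = 0 := by simp [linOp_apply, hu0]
    have hr := hfg u
    rw [hU u hu, hφu, map_zero, zero_add, zero_eq_mul, or_iff_left hu0] at hr
    have := ih g ((hg n rfl).trans hf) (U.map (linOp T (T u / u))) (by
      rintro _ ⟨v, hv, rfl⟩
      simpa [hr, hU v hv] using (hfg v).symm)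
    have := finrank_map_linOp T hT hu hu0
    omega

/-- Every subspace is annihilated by a monic operator whose degree is its dimension. -/
lemma exists_skewOp_eq_zero (hT : ∀ y, T y = y → ∃ c : K, algebraMap K F c = y)
    (n : ℕ) (U : Submodule K F) (hn : Module.finrank K U = n) :
    ∃ f : ℕ → F, f n = 1 ∧ ∀ u ∈ U, skewOp T f (n + 1) u = 0 := by
  induction n generalizing U with
  | zero =>
    obtain rfl := Submodule.finrank_eq_zero.1 hn
    exact ⟨1, rfl, by simp⟩
  | succ n ih =>
    have hne : U ≠ ⊥ := by rintro rfl; simp at hn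
    obtain ⟨u, hu, hu0⟩ := U.ne_bot_iff.1 hne
    have := finrank_map_linOp T hT hu hu0
    obtain ⟨g, hg, hgU⟩ := ih (U.map (linOp T (T u / u))) (by omega)
    obtain ⟨f, hf, hfg⟩ := exists_skewOp_eq_comp_linOp T (T u / u) n g
    exact ⟨f, hf.trans hg, fun v hv => (hfg v).trans (hgU _ ⟨v, hv, rfl⟩)⟩

/-- If a monic operator of minimal degree annihilating `U` is right divisible by `T - x`, then
`T - x` has a nontrivial kernel on `U`. -/
lemma exists_eigenvector (hT : ∀ y, T y = y → ∃ c : K, algebraMap K F c = y)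
    {U : Submodule K F} {d : ℕ} {f : ℕ → F} (hf : f d = 1)
    (hU : ∀ u ∈ U, skewOp T f (d + 1) u = 0)
    (hmin : ∀ d' < d, ∀ g : ℕ → F, g d' = 1 → ¬ ∀ u ∈ U, skewOp T g (d' + 1) u = 0)
    {x : F} (hx : ∑ i ∈ range (d + 1), f i * partialNorm T x i = 0) :
    ∃ w ∈ U, w ≠ 0 ∧ T w = x * w := by
  by_contra! hcon
  have hd : d ≤ Module.finrank K U := by
    by_contra! h
    obtain ⟨g, hg, hgU⟩ := exists_skewOp_eq_zero T hT _ U rfl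
    exact hmin _ h g hg hgU
  obtain _ | d := d
  · simp [hf, partialNorm] at hx
  obtain ⟨g, hg, hfg⟩ := exists_skewOp_eq_comp_linOp_add T x (d + 1) f
  have hle := finrank_le_of_skewOp_eq_zero T hT d g ((hg d rfl).trans hf)
    (U.map (linOp T x)) (by
      rintro _ ⟨v, hv, rfl⟩
      simpa [hx, hU v hv] using (hfg v).symm)
  have hinj : LinearMap.ker ((linOp T x).domRestrict U) = ⊥ := by
    refine (Submodule.eq_bot_iff _).2 ?_
    rintro ⟨y, hy⟩ h
    rw [LinearMap.mem_ker, LinearMap.domRestrict_apply, linOp_apply, sub_eq_zero] at h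
    by_contra hy0
    exact hcon y hy (fun h0 => hy0 (Subtype.ext h0)) h
  have h := LinearMap.finrank_range_add_finrank_ker ((linOp T x).domRestrict U)
  rw [hinj, LinearMap.range_domRestrict, finrank_bot] at h
  omega

end FrobeniusOperator

/-- In a finite field with `q ^ m` elements, the `q ^ k`-power map is a ring homomorphism. -/
lemma exists_ringHom_eq_pow {q m : ℕ} (hq : IsPrimePow q) {F : Type*} [Field F]
    [Fintype F] (hF : Fintype.card F = q ^ m) (k : ℕ) :
    ∃ τ : F →+* F, ∀ x, τ x = x ^ q ^ k := by
  obtain ⟨p, hp⟩ := CharP.exists F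
  obtain ⟨n, hpp, hn⟩ := FiniteField.card F p
  obtain ⟨r, s, hr, -, rfl⟩ := hq
  obtain rfl : p = r := (Nat.prime_dvd_prime_iff_eq hpp hr.nat_prime).1 <| by
    have : p ∣ Fintype.card F := hn ▸ dvd_pow_self p n.ne_zero
    rw [hF, ← pow_mul] at this
    exact hpp.dvd_of_dvd_pow this
  have := Fact.mk hpp
  exact ⟨iterateFrobenius F p (s * k), fun x => by rw [iterateFrobenius_def, pow_mul]⟩

/-- Left closure of `Z = {b_1^{q^{m-1}-1}, …, b_n^{q^{m-1}-1}}`: the set of left roots of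
the left minimal polynomial of `Z` (monic coefficient tuple `f` of minimal degree `d`) is
`{(∑ c_j b_j)^{q^{m-1}-1} : c_j ∈ 𝔽_q, ∑ c_j b_j ≠ 0}`, where `𝔽_q ⊆ F` is the subfield
of elements fixed by `x ↦ x^q`. -/
theorem left_closure_description (q m : ℕ) (hq : IsPrimePow q) (hm : 2 ≤ m)
    (F : Type*) [Field F] [Fintype F] (hF : Fintype.card F = q ^ m)
    (n : ℕ) (b : Fin n → F) (hb : ∀ j, b j ≠ 0)
    (a : Fin n → F) (ha : ∀ j, a j = (b j) ^ (q ^ (m - 1) - 1))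
    (d : ℕ) (f : ℕ → F) (hfd : f d = 1)
    (hroot : ∀ j, ∑ i ∈ Finset.range (d + 1), f i * (a j) ^ qbrackRev q m i = 0)
    (hmin : ¬ ∃ d' < d, ∃ g : ℕ → F, g d' = 1 ∧
      ∀ j, ∑ i ∈ Finset.range (d' + 1), g i * (a j) ^ qbrackRev q m i = 0) :
    {x : F | ∑ i ∈ Finset.range (d + 1), f i * x ^ qbrackRev q m i = 0} =
      {x : F | ∃ c : Fin n → F, (∀ j, (c j) ^ q = c j) ∧
        (∑ j, c j * b j ≠ 0) ∧ x = (∑ j, c j * b j) ^ (q ^ (m - 1) - 1)} := by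
  obtain ⟨τ, hτ⟩ := exists_ringHom_eq_pow hq hF (m - 1)
  let K : Subfield F := τ.eqLocusField (RingHom.id F)
  have hK (c : F) : c ∈ K ↔ c ^ q = c := by
    change τ c = c ↔ _
    rw [hτ]
    constructor <;> intro h
    · calc c ^ q = (c ^ q ^ (m - 1)) ^ q := by rw [h]
        _ = c ^ q ^ m := by rw [← pow_mul, ← pow_succ, Nat.sub_add_cancel (by omega)]
        _ = c := by rw [← hF, FiniteField.pow_card]
    · generalize m - 1 = k
      induction k with
      | zero => simp
      | succ k ih => rw [pow_succ, pow_mul, ih, h]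
  let T : F →ₐ[K] F := { τ with commutes' := fun c => c.2 }
  have hT (y : F) : T y = y ^ q ^ (m - 1) := hτ y
  have hTpow (i : ℕ) (y : F) : (T ^ i) y = y ^ q ^ (i * (m - 1)) := by
    induction i with
    | zero => simp
    | succ i ih => rw [pow_succ', AlgHom.mul_apply, ih, hT, ← pow_mul, ← pow_add, add_mul, one_mul]
  have hnorm (x : F) (i : ℕ) : x ^ qbrackRev q m i = FrobeniusOperator.partialNorm T x i := by
    simp only [FrobeniusOperator.partialNorm, hTpow, qbrackRev, Finset.prod_pow_eq_pow_sum]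
  have hfix (y : F) (hy : T y = y) : ∃ c : K, algebraMap K F c = y := ⟨⟨y, hy⟩, rfl⟩
  have hQ : q ^ (m - 1) - 1 + 1 = q ^ (m - 1) :=
    Nat.sub_add_cancel (Nat.one_le_pow _ _ hq.pos)
  have hTmul (y : F) : T y = y ^ (q ^ (m - 1) - 1) * y := by rw [hT, ← pow_succ, hQ]
  simp only [hnorm] at hroot hmin ⊢
  set U : Submodule K F := Submodule.span K (Set.range b)
  have hspan (g : ℕ → F) (k : ℕ) : (∀ u ∈ U, FrobeniusOperator.skewOp T g k u = 0) ↔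
      ∀ j, ∑ i ∈ Finset.range k, g i * FrobeniusOperator.partialNorm T (a j) i = 0 := by
    have h : (∀ u ∈ U, FrobeniusOperator.skewOp T g k u = 0) ↔
        U ≤ LinearMap.ker (FrobeniusOperator.skewOp T g k) := Iff.rfl
    rw [h, Submodule.span_le, Set.range_subset_iff]
    refine forall_congr' fun j => ?_
    rw [SetLike.mem_coe, LinearMap.mem_ker,
      FrobeniusOperator.skewOp_eq_sum_mul T (ha j ▸ hTmul (b j)), mul_eq_zero,
      or_iff_left (hb j)]
  have hU := (hspan f (d + 1)).2 hroot
  have hmem (w : F) : w ∈ U ↔ ∃ c : Fin n → F, (∀ j, c j ^ q = c j) ∧ ∑ j, c j * b j = w := by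
    rw [Submodule.mem_span_range_iff_exists_fun]
    constructor
    · rintro ⟨c, hc⟩
      exact ⟨fun j => c j, fun j => (hK _).1 (c j).2, hc⟩
    · rintro ⟨c, hc, h⟩
      exact ⟨fun j => ⟨c j, (hK _).2 (hc j)⟩, h⟩
  ext x
  constructor
  · intro hx
    obtain ⟨w, hw, hw0, hTw⟩ := FrobeniusOperator.exists_eigenvector T hfix hfd hU
      (fun d' hd' g hg h => hmin ⟨d', hd', g, hg, (hspan g _).1 h⟩) hx
    obtain ⟨c, hc, rfl⟩ := (hmem w).1 hw
    exact ⟨c, hc, hw0, mul_right_cancel₀ hw0 (hTw.symm.trans (hTmul _))⟩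
  · rintro ⟨c, hc, h0, rfl⟩
    have h := hU _ ((hmem _).2 ⟨c, hc, rfl⟩)
    rw [FrobeniusOperator.skewOp_eq_sum_mul T (hTmul _), mul_eq_zero, or_iff_left h0] at h
    exact h
end

section
/- Let q be a prime power, m a positive integer, and F = 𝔽_{q^m}. Let [1] = {c^{q−1} : c ∈ F^*} and define φ : [1] → F by φ(a) = a^{⟦m−1⟧} = a^{(q^{m−1}−1)/(q−1)}. Then φ maps [1] into [1] and is a bijection from [1] to [1]. -/
theorem qbrack_succ (q i : ℕ) : qbrack q (i + 1) = qbrack q i * q + 1 := by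
  simp [qbrack, Finset.sum_range_succ', pow_succ, Finset.sum_mul]

theorem qbrack_mul_pred_add_one {q : ℕ} (hq : 0 < q) (i : ℕ) :
    qbrack q i * (q - 1) + 1 = q ^ i := by
  obtain ⟨r, rfl⟩ := Nat.exists_eq_add_of_lt hq
  simpa [qbrack] using geom_sum_mul_add r i

/-- The map `φ(a) = a^⟦m-1⟧ = a^{(q^{m-1}-1)/(q-1)}` maps the conjugacy class
`[1] = {c^{q-1} : c ∈ F^*}` into itself and is a bijection from `[1]` to `[1]`. -/
theorem phi_bijection_on_class_of_one (q m : ℕ) (hq : IsPrimePow q) (hm : 0 < m)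
    (F : Type*) [Field F] [Fintype F] (hF : Fintype.card F = q ^ m)
    (H : Set F) (hH : H = {x : F | ∃ c : Fˣ, x = (c : F) ^ (q - 1)})
    (φ : F → F) (hφ : ∀ a : F, φ a = a ^ qbrack q (m - 1)) :
    Set.MapsTo φ H H ∧ Set.BijOn φ H H := by
  have mapsTo : Set.MapsTo φ H H := by
    subst hH
    rintro _ ⟨c, rfl⟩
    exact ⟨c ^ qbrack q (m - 1), by rw [hφ, Units.val_pow_eq_pow_val, pow_right_comm]⟩
  have phi_pow_mul_self : ∀ a ∈ H, φ a ^ q * a = 1 := by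
    subst hH
    rintro _ ⟨c, rfl⟩
    have card_units : (q - 1) * qbrack q m = Fintype.card F - 1 := by
      rw [hF, ← qbrack_mul_pred_add_one hq.pos m, Nat.add_sub_cancel, mul_comm]
    rw [hφ, ← pow_mul, ← pow_succ, ← qbrack_succ, Nat.sub_add_cancel hm, ← pow_mul,
      card_units, FiniteField.pow_card_sub_one_eq_one _ c.ne_zero]
  have injOn : Set.InjOn φ H := fun a ha b hb hab => by
    have h := phi_pow_mul_self a ha
    rw [← phi_pow_mul_self b hb, hab] at h
    exact mul_left_cancel₀ (left_ne_zero_of_mul_eq_one (phi_pow_mul_self b hb)) h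
  exact ⟨mapsTo, (H.toFinite.injOn_iff_bijOn_of_mapsTo mapsTo).mp injOn⟩
end

section
/- Let q be a prime power, m ≥ 2 an integer, and F = 𝔽_{q^m}. Let b_1, …, b_n ∈ F^*. Then the family (b_1^{q^{m−1}−1}, …, b_n^{q^{m−1}−1}) is left independent if and only if (b_1, …, b_n) is linearly independent over the subfield 𝔽_q of F. -/
/-- `(a_1, …, a_n)` is left independent: the only coefficient tuple whose left evaluation
vanishes at every `a_j` is zero. -/
def LeftIndep (q m : ℕ) {F : Type*} [Field F] {n : ℕ} (a : Fin n → F) : Prop :=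
  ∀ f : Fin n → F,
    (∀ j : Fin n, ∑ i : Fin n, f i * (a j) ^ qbrackRev q m (i : ℕ) = 0) → f = 0

/-- Moore-type criterion: if the `b j` are independent over the fixed points of an injective
endomorphism `θ`, then so are the rows `(b j, θ (b j), …, θ^(|s|-1) (b j))` over the whole field. -/
theorem eq_zero_of_forall_sum_mul_iterate_eq_zero {ι F : Type*} [DecidableEq ι] [Field F]
    (θ : F →+* F) (s : Finset ι) (b : ι → F)
    (hb : ∀ c : ι → F, (∀ j, θ (c j) = c j) → ∑ j ∈ s, c j * b j = 0 → ∀ j ∈ s, c j = 0)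
    (v : ι → F) (hv : ∀ i < s.card, ∑ j ∈ s, v j * θ^[i] (b j) = 0) :
    ∀ j ∈ s, v j = 0 := by
  induction s using Finset.strongInduction generalizing b v with
  | H s ih =>
  by_contra! ⟨k, hk, hvk⟩
  have hw : ∀ i < s.card, ∑ j ∈ s, v j / v k * θ^[i] (b j) = 0 := fun i hi => by
    rw [← mul_right_inj' hvk, Finset.mul_sum, mul_zero, ← hv i hi]
    refine Finset.sum_congr rfl fun j _ => ?_
    field_simp
  have hb' : ∀ c : ι → F, (∀ j, θ (c j) = c j) → ∑ j ∈ s.erase k, c j * θ (b j) = 0 →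
      ∀ j ∈ s.erase k, c j = 0 := by
    intro c hc hsum j hj
    have hsum' : ∑ j ∈ s.erase k, c j * b j = 0 := by
      apply θ.injective
      rw [map_sum, map_zero, ← hsum]
      exact Finset.sum_congr rfl fun j _ => by rw [map_mul, hc]
    have := hb (fun j => if j = k then 0 else c j)
      (fun j => by by_cases h : j = k <;> simp [h, hc]) (by
        rw [← Finset.add_sum_erase s _ hk]
        simp only [if_true, zero_mul, zero_add]
        rw [← hsum']
        exact Finset.sum_congr rfl fun j hj => by rw [if_neg (Finset.ne_of_mem_erase hj)])
      j (Finset.mem_of_mem_erase hj)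
    simpa [Finset.ne_of_mem_erase hj] using this
  have hfix : ∀ j ∈ s.erase k, θ (v j / v k) - v j / v k = 0 := by
    refine ih _ (Finset.erase_ssubset hk) (fun j => θ (b j)) hb'
      (fun j => θ (v j / v k) - v j / v k) fun i hi => ?_
    rw [Finset.card_erase_of_mem hk] at hi
    have h₁ : ∑ j ∈ s, θ (v j / v k) * θ^[i] (θ (b j)) = 0 := by
      rw [← map_zero θ, ← hw i (by omega), map_sum]
      refine Finset.sum_congr rfl fun j _ => ?_
      rw [map_mul, ← Function.iterate_succ_apply, Function.iterate_succ_apply']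
    have h₂ : ∑ j ∈ s, v j / v k * θ^[i] (θ (b j)) = 0 := hw (i + 1) (by omega)
    have h₃ : ∑ j ∈ s, (θ (v j / v k) - v j / v k) * θ^[i] (θ (b j)) = 0 := by
      simp only [sub_mul, Finset.sum_sub_distrib, h₁, h₂, sub_zero]
    rw [← Finset.add_sum_erase s _ hk] at h₃
    simpa [div_self hvk] using h₃
  have hfix' : ∀ j ∈ s, θ (v j / v k) = v j / v k := fun j hj => by
    by_cases h : j = k
    · simp [h, div_self hvk]
    · exact sub_eq_zero.mp (hfix j (Finset.mem_erase.mpr ⟨h, hj⟩))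
  have hzero := hb (fun j => if j ∈ s then v j / v k else 0)
    (fun j => by by_cases h : j ∈ s <;> simp only [h, if_true, if_false, map_zero, hfix'])
    (by
      rw [← hw 0 (Finset.card_pos.mpr ⟨k, hk⟩)]
      exact Finset.sum_congr rfl fun j hj => by simp [hj]) k hk
  simp [hk, hvk] at hzero

theorem pred_mul_qbrackRev_add_one {q : ℕ} (hq : 0 < q) (m i : ℕ) :
    (q ^ (m - 1) - 1) * qbrackRev q m i + 1 = (q ^ (m - 1)) ^ i := by
  have h := geom_sum_mul_add (q ^ (m - 1) - 1) i
  rw [Nat.sub_add_cancel (Nat.one_le_pow _ _ hq)] at h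
  rw [← h, mul_comm, qbrackRev]
  simp only [← pow_mul, mul_comm]

theorem pow_pow_pred_eq_self_iff {q m : ℕ} (hm : 1 ≤ m) {F : Type*} [Field F] [Fintype F]
    (hF : Fintype.card F = q ^ m) (c : F) : c ^ q ^ (m - 1) = c ↔ c ^ q = c := by
  refine ⟨fun h => ?_, fun h => ?_⟩
  · have hc := FiniteField.pow_card c
    rwa [hF, ← Nat.sub_add_cancel hm, pow_succ, pow_mul, h] at hc
  · have hfix : Function.IsFixedPt (fun x : F => x ^ q) c := h
    simpa only [Function.IsFixedPt, pow_iterate] using hfix.iterate (m - 1)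

/-- The power map `x ↦ x ^ q ^ k` is a ring endomorphism of a field with `q ^ m` elements. -/
theorem exists_ringHom_forall_eq_pow {q m : ℕ} (hq : IsPrimePow q) {F : Type*} [Field F]
    [Fintype F] (hF : Fintype.card F = q ^ m) (k : ℕ) :
    ∃ θ : F →+* F, ∀ x, θ x = x ^ q ^ k := by
  obtain ⟨p, a, hp, -, rfl⟩ := (isPrimePow_nat_iff q).mp hq
  have : Fact p.Prime := ⟨hp⟩
  have : CharP F p := charP_of_card_eq_prime_pow (f := a * m) (by
    rw [hF, pow_mul])
  exact ⟨iterateFrobenius F p (a * k), fun x => by rw [iterateFrobenius_def, pow_mul]⟩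

/-- The family `(b_1^{q^{m-1}-1}, …, b_n^{q^{m-1}-1})` is left independent iff
`(b_1, …, b_n)` is linearly independent over the subfield `𝔽_q = {c : c^q = c}` of `F`. -/
theorem leftIndep_iff_linearIndependent (q m : ℕ) (hq : IsPrimePow q) (hm : 2 ≤ m)
    (F : Type*) [Field F] [Fintype F] (hF : Fintype.card F = q ^ m)
    (n : ℕ) (b : Fin n → F) (hb : ∀ j, b j ≠ 0) :
    LeftIndep q m (fun j => (b j) ^ (q ^ (m - 1) - 1)) ↔
      (∀ c : Fin n → F, (∀ j, (c j) ^ q = c j) → ∑ j, c j * b j = 0 → c = 0) := by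
  classical
  obtain ⟨θ, hθ⟩ := exists_ringHom_forall_eq_pow hq hF (m - 1)
  have hfix (x : F) : θ x = x ↔ x ^ q = x := by
    rw [hθ, pow_pow_pred_eq_self_iff (by omega) hF]
  have hiter (i : ℕ) (x : F) : θ^[i] x = x ^ (q ^ (m - 1)) ^ i := by
    rw [show ⇑θ = fun x => x ^ q ^ (m - 1) from funext hθ, pow_iterate]
  let M : Matrix (Fin n) (Fin n) F := Matrix.of fun j i => θ^[i] (b j)
  have hleft : LeftIndep q m (fun j => b j ^ (q ^ (m - 1) - 1)) ↔
      ∀ f : Fin n → F, M.mulVec f = 0 → f = 0 := by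
    refine forall_congr' fun f => imp_congr_left ?_
    rw [funext_iff]
    refine forall_congr' fun j => ?_
    have hentry (i : Fin n) :
        M j i = b j * (b j ^ (q ^ (m - 1) - 1)) ^ qbrackRev q m i := by
      rw [← pow_mul, ← pow_succ', pred_mul_qbrackRev_add_one hq.pos]
      exact hiter i (b j)
    simp only [Matrix.mulVec, dotProduct, hentry, mul_assoc, ← Finset.mul_sum, Pi.zero_apply,
      mul_eq_zero, hb j, false_or, mul_comm (f _)]
  have hright : (∀ v : Fin n → F, Matrix.vecMul v M = 0 → v = 0) ↔
      ∀ f : Fin n → F, M.mulVec f = 0 → f = 0 := by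
    rw [← not_iff_not]
    push Not
    simp only [and_comm (a := _ = _)]
    rw [Matrix.exists_vecMul_eq_zero_iff, Matrix.exists_mulVec_eq_zero_iff]
  rw [hleft, ← hright]
  refine ⟨fun h c hc hsum => h c ?_, fun h v hv => ?_⟩
  · ext i
    have hc' (j : Fin n) : θ^[i] (c j) = c j :=
      Function.IsFixedPt.iterate ((hfix _).mpr (hc j)) i
    have := congrArg (θ ^ (i : ℕ)) hsum
    simp only [map_sum, map_mul, map_zero, RingHom.coe_pow, hc'] at this
    exact this
  · refine funext fun j => eq_zero_of_forall_sum_mul_iterate_eq_zero θ Finset.univ b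
      (fun c hc hsum j _ => congrFun (h c (fun j => (hfix _).mp (hc j)) hsum) j) v
      (fun i hi => ?_) j (Finset.mem_univ j)
    exact congrFun hv ⟨i, by simpa using hi⟩
end

section
/- Let q be a prime power, m ≥ 2 an integer, and F = 𝔽_{q^m}. Let a_1, …, a_n ∈ [1] = {c^{q−1} : c ∈ F^*} and let φ(a) = a^{(q^{m−1}−1)/(q−1)}. Then the family (a_1, …, a_n) is right independent if and only if the family (φ(a_1), …, φ(a_n)) is left independent. In particular, φ is an isomorphism between the matroid of right independent subsets of [1] and the matroid of left independent subsets of [1]. -/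
theorem sub_one_mul_qbrack (q i : ℕ) (hq : 1 ≤ q) : (q - 1) * qbrack q i = q ^ i - 1 := by
  obtain ⟨r, rfl⟩ := Nat.exists_eq_add_of_le' hq
  have := geom_sum_mul_add r i
  rw [Nat.add_sub_cancel, qbrack, mul_comm, ← this, Nat.add_sub_cancel]

theorem pow_qbrack_mul_self {F : Type*} [Field F] (q i : ℕ) (hq : 1 ≤ q) (c : F) :
    (c ^ (q - 1)) ^ qbrack q i * c = c ^ q ^ i := by
  rw [← pow_mul, ← pow_succ, sub_one_mul_qbrack q i hq, Nat.sub_add_cancel (Nat.one_le_pow _ _ hq)]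

/-- Applying a left inverse of `τ` sufficiently often turns the powers of `τ` into powers of `σ`
in reversed order. -/
theorem eq_zero_of_sum_iterate_eq_zero {F : Type*} [Field F] {n : ℕ} (c : Fin n → F)
    (σ τ : F →+* F) (hστ : Function.LeftInverse σ τ)
    (hσ : ∀ f : Fin n → F, (∀ j, ∑ i, f i * σ^[(i : ℕ)] (c j) = 0) → f = 0)
    (f : Fin n → F) (hf : ∀ j, ∑ i, f i * τ^[(i : ℕ)] (c j) = 0) : f = 0 := by
  have key : (fun i : Fin n => (σ ^ (n - 1)) (f i.rev)) = 0 := by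
    refine hσ _ fun j => ?_
    rw [← map_zero (σ ^ (n - 1)), ← hf j, map_sum, ← Equiv.sum_comp Fin.revPerm]
    refine Finset.sum_congr rfl fun i _ => ?_
    rw [map_mul, Fin.revPerm_apply, Fin.rev_rev, RingHom.coe_pow]
    congr 1
    have hi : n - 1 = (i.rev : ℕ) + i := by rw [Fin.val_rev]; omega
    rw [hi, Function.iterate_add_apply, hστ.iterate]
  funext i
  have h := congrFun key i.rev
  rw [Fin.rev_rev] at h
  exact (map_eq_zero (σ ^ (n - 1))).1 h

theorem sum_mul_eq_zero_iff_of_mul_eq {F : Type*} [Field F] {n : ℕ} (f u v : Fin n → F) {c : F}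
    (hc : c ≠ 0) (h : ∀ i, u i * c = v i) : ∑ i, f i * u i = 0 ↔ ∑ i, f i * v i = 0 := by
  have : ∑ i, f i * v i = (∑ i, f i * u i) * c := by
    rw [Finset.sum_mul]
    exact Finset.sum_congr rfl fun i _ => by rw [← h i, mul_assoc]
  rw [this, mul_eq_zero, or_iff_left hc]

/-- For `a_1, …, a_n ∈ [1] = {c^{q-1} : c ∈ F^*}` and `φ(a) = a^{(q^{m-1}-1)/(q-1)} = a^⟦m-1⟧`,
the family `(a_1, …, a_n)` is right independent iff `(φ(a_1), …, φ(a_n))` is left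
independent; so `φ` is an isomorphism between the matroid of right independent subsets of
`[1]` and the matroid of left independent subsets of `[1]`. -/
theorem phi_matroid_isomorphism (q m : ℕ) (hq : IsPrimePow q) (hm : 2 ≤ m)
    (F : Type*) [Field F] [Fintype F] (hF : Fintype.card F = q ^ m)
    (n : ℕ) (a : Fin n → F) (ha : ∀ j, ∃ c : Fˣ, a j = (c : F) ^ (q - 1))
    (φ : F → F) (hφ : ∀ x : F, φ x = x ^ qbrack q (m - 1)) :
    RightIndep q a ↔ LeftIndep q m (fun j => φ (a j)) := by
  obtain ⟨p, k, hp, -, rfl⟩ := hq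
  have : Fact p.Prime := ⟨hp.nat_prime⟩
  rw [← pow_mul] at hF
  have : CharP F p := charP_of_card_eq_prime_pow hF
  have hq1 : 1 ≤ p ^ k := Nat.one_le_pow _ _ hp.nat_prime.pos
  choose c hc using ha
  set σ : F →+* F := iterateFrobenius F p k with hσ
  set τ : F →+* F := iterateFrobenius F p (k * (m - 1)) with hτ
  have σ_iter (i : ℕ) (x : F) : σ^[i] x = x ^ (p ^ k) ^ i := by
    rw [hσ, show ⇑(iterateFrobenius F p k) = (· ^ p ^ k) from
      funext (iterateFrobenius_def p k), pow_iterate]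
  have τ_iter (i : ℕ) (x : F) : τ^[i] x = x ^ ((p ^ k) ^ (m - 1)) ^ i := by
    rw [hτ, show ⇑(iterateFrobenius F p (k * (m - 1))) = (· ^ p ^ (k * (m - 1))) from
      funext (iterateFrobenius_def p _), pow_iterate, pow_mul]
  have hcomp : p ^ (k * (m - 1)) * p ^ k = Fintype.card F := by
    rw [hF, ← pow_add, ← Nat.mul_succ, Nat.succ_eq_add_one, Nat.sub_add_cancel (by omega)]
  have hστ : Function.LeftInverse σ τ := fun x => by
    rw [hσ, hτ, iterateFrobenius_def, iterateFrobenius_def, ← pow_mul, hcomp, FiniteField.pow_card]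
  have hτσ : Function.LeftInverse τ σ := fun x => by
    rw [hσ, hτ, iterateFrobenius_def, iterateFrobenius_def, ← pow_mul, mul_comm, hcomp,
      FiniteField.pow_card]
  have hright (f : Fin n → F) (j : Fin n) : ∑ i : Fin n, f i * a j ^ qbrack (p ^ k) i = 0 ↔
      ∑ i : Fin n, f i * σ^[(i : ℕ)] (c j : F) = 0 :=
    sum_mul_eq_zero_iff_of_mul_eq f _ _ (c j).ne_zero fun i => by
      rw [hc, pow_qbrack_mul_self _ _ hq1, σ_iter]
  have hleft (f : Fin n → F) (j : Fin n) :
      ∑ i : Fin n, f i * φ (a j) ^ qbrackRev (p ^ k) m i = 0 ↔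
        ∑ i : Fin n, f i * τ^[(i : ℕ)] (c j : F) = 0 :=
    sum_mul_eq_zero_iff_of_mul_eq f _ _ (c j).ne_zero fun i => by
      have hφa : φ (a j) = (c j : F) ^ ((p ^ k) ^ (m - 1) - 1) := by
        rw [hφ, hc, ← pow_mul, sub_one_mul_qbrack _ _ hq1]
      have hrev : qbrackRev (p ^ k) m i = qbrack ((p ^ k) ^ (m - 1)) i :=
        Finset.sum_congr rfl fun l _ => by rw [mul_comm l, pow_mul]
      rw [hφa, hrev, pow_qbrack_mul_self _ _ (Nat.one_le_pow _ _ hq1), τ_iter]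
  simp only [RightIndep, LeftIndep, hright, hleft]
  exact ⟨eq_zero_of_sum_iterate_eq_zero _ σ τ hστ, eq_zero_of_sum_iterate_eq_zero _ τ σ hτσ⟩
end

section
/- Let q be a prime power, m a positive integer, F = 𝔽_{q^m}, and let K be a finite field containing F. Let n ≥ 1 and f_0, …, f_n ∈ F with f_0 ≠ 0 and f_n ≠ 0, let P(y) = ∑_{i=0}^{n} f_i y^{⟦i⟧}, and suppose P has ⟦n⟧ = (q^n − 1)/(q − 1) distinct roots in K. Then all roots of P in K lie in a single σ-conjugacy class of K: for any two roots a, b ∈ K of P, there exists c ∈ K^* with b = a c^{q−1}. -/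
open Polynomial

open scoped Classical

theorem qbrack_zero (q : ℕ) : qbrack q 0 = 0 := rfl

theorem qbrack_mono (q : ℕ) : Monotone (qbrack q) := fun _ _ h =>
  Finset.sum_le_sum_of_subset (Finset.range_subset_range.2 h)

theorem qbrack_pos {q i : ℕ} (hi : i ≠ 0) : 0 < qbrack q i := by
  refine lt_of_lt_of_le ?_ (qbrack_mono q (Nat.one_le_iff_ne_zero.2 hi))
  simp [qbrack]

theorem sub_one_mul_qbrack_add_one {q : ℕ} (hq : 0 < q) (i : ℕ) :
    (q - 1) * qbrack q i + 1 = q ^ i := by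
  obtain ⟨r, rfl⟩ := Nat.exists_eq_add_of_le' hq
  induction i with
  | zero => simp [qbrack]
  | succ i ih =>
    rw [qbrack, Finset.sum_range_succ, ← qbrack, pow_succ, ← ih, Nat.add_sub_cancel] at *
    linear_combination r * ih

/-- The right evaluation polynomial `∑_{i ≤ n} f_i y^⟦i⟧`. -/
noncomputable def rightEvalPoly {R : Type*} [CommSemiring R] (q n : ℕ) (f : ℕ → R) : R[X] :=
  ∑ i ∈ Finset.range (n + 1), C (f i) * X ^ qbrack q i

theorem eval_rightEvalPoly {R : Type*} [CommSemiring R] (q n : ℕ) (f : ℕ → R) (y : R) :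
    (rightEvalPoly q n f).eval y = ∑ i ∈ Finset.range (n + 1), f i * y ^ qbrack q i := by
  simp [rightEvalPoly, eval_finsetSum]

theorem map_rightEvalPoly {R S : Type*} [CommSemiring R] [CommSemiring S] (g : R →+* S)
    (q n : ℕ) (f : ℕ → R) :
    (rightEvalPoly q n f).map g = rightEvalPoly q n fun i => g (f i) := by
  simp [rightEvalPoly, Polynomial.map_sum]

theorem eval_zero_rightEvalPoly {R : Type*} [CommSemiring R] (q n : ℕ) (f : ℕ → R) :
    (rightEvalPoly q n f).eval 0 = f 0 := by
  rw [eval_rightEvalPoly, Finset.sum_eq_single 0]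
  · simp [qbrack_zero]
  · intro i _ hi
    simp [(qbrack_pos hi).ne']
  · simp

theorem natDegree_rightEvalPoly_le {R : Type*} [CommSemiring R] (q n : ℕ) (f : ℕ → R) :
    (rightEvalPoly q n f).natDegree ≤ qbrack q n :=
  natDegree_sum_le_of_forall_le _ _ fun _ hi =>
    (natDegree_C_mul_X_pow_le _ _).trans
      (qbrack_mono q (Nat.lt_succ_iff.1 (Finset.mem_range.1 hi)))

theorem mul_eval_rightEvalPoly_pow {R : Type*} [CommSemiring R] {q : ℕ} (hq : 0 < q) (n : ℕ)
    (f : ℕ → R) (v : R) :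
    v * (rightEvalPoly q n f).eval (v ^ (q - 1)) =
      ∑ i ∈ Finset.range (n + 1), f i * v ^ q ^ i := by
  rw [eval_rightEvalPoly, Finset.mul_sum]
  refine Finset.sum_congr rfl fun i _ => ?_
  rw [← sub_one_mul_qbrack_add_one hq i]
  ring

theorem eval_rightEvalPoly_add_pow {R : Type*} [CommRing R] [IsDomain R] {p k : ℕ}
    [Fact p.Prime] [CharP R p] (n : ℕ) (f : ℕ → R) {v w : R}
    (hv : (rightEvalPoly (p ^ k) n f).eval (v ^ (p ^ k - 1)) = 0)
    (hw : (rightEvalPoly (p ^ k) n f).eval (w ^ (p ^ k - 1)) = 0) (hvw : v + w ≠ 0) :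
    (rightEvalPoly (p ^ k) n f).eval ((v + w) ^ (p ^ k - 1)) = 0 := by
  have hq : 0 < p ^ k := pow_pos (Fact.out : p.Prime).pos k
  refine (mul_eq_zero.1 ?_).resolve_left hvw
  have h1 := mul_eval_rightEvalPoly_pow hq n f v
  have h2 := mul_eval_rightEvalPoly_pow hq n f w
  rw [hv, mul_zero] at h1
  rw [hw, mul_zero] at h2
  rw [mul_eval_rightEvalPoly_pow hq, ← add_zero (0 : R)]
  nth_rw 1 [h1]
  rw [h2, ← Finset.sum_add_distrib]
  refine Finset.sum_congr rfl fun i _ => ?_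
  rw [← pow_mul, add_pow_char_pow, mul_add]

theorem exists_algebraMap_eq_of_pow_card_eq {K L : Type*} [Field K] [Fintype K] [Field L]
    [Algebra K L] {x : L} (hx : x ^ Fintype.card K = x) : ∃ c : K, algebraMap K L c = x := by
  have h0 : (X ^ Fintype.card K - X : K[X]) ≠ 0 :=
    FiniteField.X_pow_card_sub_X_ne_zero K Fintype.one_lt_card
  have hs : (X ^ Fintype.card K - X : K[X]).Splits := by
    rw [splits_iff_card_roots, FiniteField.roots_X_pow_card_sub_X,
      FiniteField.X_pow_card_sub_X_natDegree_eq K Fintype.one_lt_card]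
    rfl
  have := hs.mem_range_of_isRoot (f := X ^ Fintype.card K - X) (i := algebraMap K L) h0
    (x := x) (by simp [hx])
  simpa using this

/-- If `v`, `w` and `v + w` have `(q-1)`-th powers in the finite field `K`, then `v ^ (q-1)` and
`w ^ (q-1)` are conjugate in `K`. -/
theorem exists_conjugate_of_pow_mem {K L : Type*} [Field K] [Fintype K] [Field L] [Algebra K L]
    {p k : ℕ} [Fact p.Prime] [CharP K p] [CharP L p] {v w : L} {a b d : K}
    (ha : a ≠ 0) (hb : b ≠ 0) (hd : d ≠ 0)
    (hva : v ^ (p ^ k - 1) = algebraMap K L a) (hwb : w ^ (p ^ k - 1) = algebraMap K L b)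
    (hud : (v + w) ^ (p ^ k - 1) = algebraMap K L d) (hv : v ≠ 0) (hw : w ≠ 0) :
    ∃ c : Kˣ, b = a * (c : K) ^ (p ^ k - 1) := by
  have hq : 0 < p ^ k := pow_pos (Fact.out : p.Prime).pos k
  obtain ⟨e, -, he⟩ := FiniteField.card K p
  have hQ : Fintype.card K - 1 + 1 = Fintype.card K := Nat.sub_add_cancel Fintype.card_pos
  have hfix : ∀ {x : L} {c : K}, c ≠ 0 → x ^ (p ^ k - 1) = algebraMap K L c →
      (x ^ (Fintype.card K - 1)) ^ p ^ k = x ^ (Fintype.card K - 1) := by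
    intro x c hc hx
    have h1 : (x ^ (Fintype.card K - 1)) ^ (p ^ k - 1) = 1 := by
      rw [pow_right_comm, hx, ← map_pow, FiniteField.pow_card_sub_one_eq_one c hc, map_one]
    conv_lhs => rw [← Nat.sub_add_cancel hq, pow_succ, h1, one_mul]
  have hlin : (v + w) * (v + w) ^ (Fintype.card K - 1) =
      v * v ^ (Fintype.card K - 1) + w * w ^ (Fintype.card K - 1) := by
    simp only [← pow_succ', hQ]
    rw [he, add_pow_char_pow]
  have hlv := hfix ha hva
  have hlw := hfix hb hwb
  have hlu := hfix hd hud
  set α := v ^ (Fintype.card K - 1) with hα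
  set β := w ^ (Fintype.card K - 1) with hβ
  set δ := (v + w) ^ (Fintype.card K - 1)
  have hα0 : α ≠ 0 := pow_ne_zero _ hv
  have hrel : v * (δ - α) = w * (β - δ) := by linear_combination hlin
  by_cases h : δ = α
  · have hβδ : β = δ := by
      rw [h, sub_self, mul_zero, ← h] at hrel
      exact sub_eq_zero.1 ((mul_eq_zero.1 hrel.symm).resolve_left hw)
    have hfixed : (w / v) ^ Fintype.card K = w / v := by
      rw [← hQ, pow_succ, div_pow, ← hα, ← hβ, hβδ, h, div_self hα0, one_mul]
    obtain ⟨c, hc⟩ := exists_algebraMap_eq_of_pow_card_eq hfixed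
    have hc0 : c ≠ 0 := by
      rintro rfl
      exact div_ne_zero hw hv (by rw [← hc, map_zero])
    refine ⟨Units.mk0 c hc0, (algebraMap K L).injective ?_⟩
    rw [Units.val_mk0, map_mul, map_pow, hc, ← hva, ← hwb, ← mul_pow, mul_div_cancel₀ _ hv]
  · have hδα : δ - α ≠ 0 := sub_ne_zero.2 h
    have hβδ : β - δ ≠ 0 := by
      intro h0
      rw [h0, mul_zero] at hrel
      exact (mul_ne_zero hv hδα) hrel
    have hone : ∀ {x : L}, x ≠ 0 → x ^ p ^ k = x → x ^ (p ^ k - 1) = 1 := by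
      intro x hx hxq
      rw [← Nat.sub_add_cancel hq, pow_succ] at hxq
      exact mul_right_cancel₀ hx (by simpa using hxq)
    have h1 := hone hδα (by rw [sub_pow_char_pow, hlu, hlv])
    have h2 := hone hβδ (by rw [sub_pow_char_pow, hlw, hlu])
    refine ⟨1, (algebraMap K L).injective ?_⟩
    have := congrArg (· ^ (p ^ k - 1)) hrel
    simp only [mul_pow, h1, h2, mul_one] at this
    simpa [← hva, ← hwb] using this.symm

/-- If the right evaluation polynomial `P(y) = ∑_{i=0}^n f_i y^⟦i⟧` (with `f_0 ≠ 0`,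
`f_n ≠ 0`) has `⟦n⟧` distinct roots in a finite field `K ⊇ F = 𝔽_{q^m}`, then all its
roots in `K` lie in a single σ-conjugacy class: for any roots `a, b` there is `c ∈ K^*`
with `b = a c^{q-1}`. -/
theorem roots_in_splitting_field_one_class (q m : ℕ) (hq : IsPrimePow q) (hm : 0 < m)
    (F : Type*) [Field F] [Fintype F] (hF : Fintype.card F = q ^ m)
    (K : Type*) [Field K] [Fintype K] [Algebra F K]
    (n : ℕ) (hn : 1 ≤ n) (f : ℕ → F) (hf0 : f 0 ≠ 0) (hfn : f n ≠ 0)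
    (P : F[X]) (hP : P = ∑ i ∈ Finset.range (n + 1), C (f i) * X ^ qbrack q i)
    (hsplit : (P.map (algebraMap F K)).roots.toFinset.card = qbrack q n) :
    ∀ a b : K, (P.map (algebraMap F K)).eval a = 0 →
      (P.map (algebraMap F K)).eval b = 0 →
      ∃ c : Kˣ, b = a * (c : K) ^ (q - 1) := by
  intro a b hPa hPb
  obtain ⟨p, k, hp, hk, rfl⟩ := (isPrimePow_nat_iff q).1 hq
  have : Fact p.Prime := ⟨hp⟩
  have : CharP F p := charP_of_card_eq_prime_pow (f := k * m) (by rw [hF, pow_mul])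
  have : CharP K p := charP_of_injective_algebraMap (algebraMap F K).injective p
  let L := AlgebraicClosure K
  have : CharP L p := charP_of_injective_algebraMap (algebraMap K L).injective p
  have hq1 : 0 < p ^ k - 1 := Nat.sub_pos_of_lt (Nat.one_lt_pow hk.ne' hp.one_lt)
  have hPK : P.map (algebraMap F K) =
      rightEvalPoly (p ^ k) n fun i => algebraMap F K (f i) := by
    rw [hP, ← map_rightEvalPoly, rightEvalPoly]
  rw [hPK] at hPa hPb hsplit
  set g : ℕ → K := fun i => algebraMap F K (f i)
  have hg0 : g 0 ≠ 0 := by simpa [g] using hf0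
  have hroot : ∀ {y : K}, (rightEvalPoly (p ^ k) n g).eval y = 0 → y ≠ 0 := by
    rintro y hy rfl
    exact hg0 (by rw [← hy, eval_zero_rightEvalPoly])
  have hne : rightEvalPoly (p ^ k) n g ≠ 0 := by
    intro h
    exact hg0 (by rw [← eval_zero_rightEvalPoly (p ^ k) n g, h, eval_zero])
  have hs : (rightEvalPoly (p ^ k) n g).Splits := by
    rw [splits_iff_card_roots]
    refine le_antisymm (card_roots' _) ((natDegree_rightEvalPoly_le _ _ _).trans ?_)
    exact hsplit ▸ Multiset.toFinset_card_le _
  obtain ⟨v, hv⟩ := IsAlgClosed.exists_pow_nat_eq (algebraMap K L a) hq1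
  obtain ⟨w, hw⟩ := IsAlgClosed.exists_pow_nat_eq (algebraMap K L b) hq1
  have hlift : ∀ {x : L} {c : K}, c ≠ 0 → x ^ (p ^ k - 1) = algebraMap K L c → x ≠ 0 := by
    rintro x c hc hx rfl
    rw [zero_pow hq1.ne'] at hx
    exact hc ((map_eq_zero _).1 hx.symm)
  have hv0 := hlift (hroot hPa) hv
  have hw0 := hlift (hroot hPb) hw
  by_cases hvw : v + w = 0
  · refine ⟨-1, (algebraMap K L).injective ?_⟩
    rw [Units.val_neg, Units.val_one, map_mul, map_pow, map_neg, map_one, ← hv, ← hw, ← mul_pow,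
      eq_neg_of_add_eq_zero_right hvw, mul_neg_one]
  · have hmap : ∀ {y : K}, (rightEvalPoly (p ^ k) n g).eval y = 0 →
        (rightEvalPoly (p ^ k) n fun i => algebraMap K L (g i)).eval (algebraMap K L y) = 0 := by
      intro y hy
      rw [← map_rightEvalPoly, eval_map_apply, hy, map_zero]
    have hu := eval_rightEvalPoly_add_pow n _ (hv ▸ hmap hPa) (hw ▸ hmap hPb) hvw
    rw [← map_rightEvalPoly] at hu
    obtain ⟨d, hd⟩ := hs.mem_range_of_isRoot hne hu
    have hd0 : d ≠ 0 := by
      rintro rfl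
      exact pow_ne_zero _ hvw (by rw [← hd, map_zero])
    exact exists_conjugate_of_pow_mem (hroot hPa) (hroot hPb) hd0 hv hw hd.symm hv0 hw0
end
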